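/- For every natural number n, every collection of points x_1, …, x_n in ℝ^d, every collection of real symmetric positive definite d×d matrices Σ_1, …, Σ_n, and every σ_f > 0, the n×n matrix K with entries K_{ij} = σ_f² · (det Σ_i)^{1/4} (det Σ_j)^{1/4} · det((Σ_i + Σ_j)/2)^{-1/2} · exp(−(x_i − x_j)ᵀ ((Σ_i + Σ_j)/2)^{-1} (x_i − x_j)) is positive semidefinite. -/

import Mathlib

open Matrix Real

open MeasureTheory

lemma integral_exp_neg_four_mul_dotProduct_self_pos {ι : Type*} [Fintype ι] :
    0 < ∫ v : ι → ℝ, Real.exp (-4 * (v ⬝ᵥ v)) := by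
  have h (v : ι → ℝ) : Real.exp (-4 * (v ⬝ᵥ v)) = ∏ i, Real.exp (-4 * v i ^ 2) := by
    rw [← Real.exp_sum, dotProduct, Finset.mul_sum]
    simp only [sq]
  simp_rw [h]
  rw [integral_fintype_prod_volume_eq_pow (fun x : ℝ => Real.exp (-4 * x ^ 2)), integral_gaussian]
  positivity

section

variable {ι : Type*} [Fintype ι] [DecidableEq ι]

lemma Matrix.integral_comp_mulVec {L : Matrix ι ι ℝ} (hL : L.det ≠ 0) (f : (ι → ℝ) → ℝ) :
    ∫ v, f (L *ᵥ v) = |L.det|⁻¹ * ∫ v, f v := by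
  have hemb : MeasurableEmbedding (toLin' L) := by
    have hcont : Continuous (toLin' L) := LinearMap.continuous_of_finiteDimensional _
    refine hcont.measurableEmbedding ?_
    intro v w h
    exact mulVec_injective_of_isUnit ((isUnit_iff_isUnit_det L).2 hL.isUnit) (by simpa using h)
  have h := hemb.integral_map (μ := volume) f
  rw [Real.map_matrix_volume_pi_eq_smul_volume_pi hL, integral_smul_measure,
    ENNReal.toReal_ofReal (abs_nonneg _), abs_inv] at h
  simpa using h.symm

lemma Matrix.PosDef.integral_exp_neg_four_mul {Q : Matrix ι ι ℝ} (hQ : Q.PosDef) :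
    ∫ v : ι → ℝ, Real.exp (-4 * (v ⬝ᵥ (Q *ᵥ v))) =
      Q.det ^ (-(1 : ℝ) / 2) * ∫ v : ι → ℝ, Real.exp (-4 * (v ⬝ᵥ v)) := by
  obtain ⟨L, rfl⟩ : ∃ L : Matrix ι ι ℝ, Q = Lᴴ * L := by
    open scoped MatrixOrder in
    exact CStarAlgebra.nonneg_iff_eq_star_mul_self.mp hQ.posSemidef.nonneg
  have hdet : (Lᴴ * L).det = L.det ^ 2 := by
    rw [det_mul, det_conjTranspose, star_trivial, sq]
  have hL : L.det ≠ 0 := by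
    intro h
    have := hQ.det_pos
    rw [hdet, h] at this
    norm_num at this
  have hquad (v : ι → ℝ) : v ⬝ᵥ ((Lᴴ * L) *ᵥ v) = (L *ᵥ v) ⬝ᵥ (L *ᵥ v) := by
    rw [← mulVec_mulVec, dotProduct_mulVec, conjTranspose_eq_transpose_of_trivial,
      vecMul_transpose]
  simp_rw [hquad]
  rw [integral_comp_mulVec hL (fun v => Real.exp (-4 * (v ⬝ᵥ v))), hdet, neg_div,
    Real.rpow_neg (sq_nonneg _), ← Real.sqrt_eq_rpow, Real.sqrt_sq_eq_abs]

/-- Completing the square in a sum of two quadratic forms with different centres. -/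
lemma Matrix.PosDef.two_mul_quadratic_add_quadratic {S T : Matrix ι ι ℝ}
    (hS : S.PosDef) (hT : T.PosDef) (a b v : ι → ℝ) :
    2 * ((v + (a - (2 : ℝ)⁻¹ • S *ᵥ (((2 : ℝ)⁻¹ • (S + T))⁻¹ *ᵥ (a - b))) - a) ⬝ᵥ (S⁻¹ *ᵥ
        (v + (a - (2 : ℝ)⁻¹ • S *ᵥ (((2 : ℝ)⁻¹ • (S + T))⁻¹ *ᵥ (a - b))) - a))) +
      2 * ((v + (a - (2 : ℝ)⁻¹ • S *ᵥ (((2 : ℝ)⁻¹ • (S + T))⁻¹ *ᵥ (a - b))) - b) ⬝ᵥ (T⁻¹ *ᵥ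
        (v + (a - (2 : ℝ)⁻¹ • S *ᵥ (((2 : ℝ)⁻¹ • (S + T))⁻¹ *ᵥ (a - b))) - b))) =
    4 * (v ⬝ᵥ (((2 : ℝ)⁻¹ • (S⁻¹ + T⁻¹)) *ᵥ v)) +
      (a - b) ⬝ᵥ (((2 : ℝ)⁻¹ • (S + T))⁻¹ *ᵥ (a - b)) := by
  have hM : ((2 : ℝ)⁻¹ • (S + T)).PosDef := (hS.add hT).smul (by norm_num)
  set w := ((2 : ℝ)⁻¹ • (S + T))⁻¹ *ᵥ (a - b) with hw
  have hMw : (2 : ℝ)⁻¹ • (S *ᵥ w + T *ᵥ w) = a - b := by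
    rw [← add_mulVec, ← smul_mulVec, hw, mulVec_mulVec,
      mul_nonsing_inv _ hM.det_pos.ne'.isUnit, one_mulVec]
  have hleft : v + (a - (2 : ℝ)⁻¹ • S *ᵥ w) - a = v - (2 : ℝ)⁻¹ • S *ᵥ w := by abel
  have hright : v + (a - (2 : ℝ)⁻¹ • S *ᵥ w) - b = v + (2 : ℝ)⁻¹ • T *ᵥ w := by
    rw [← sub_add_cancel a b, ← hMw, smul_add]
    abel
  have hquad {P : Matrix ι ι ℝ} (hP : P.PosDef) (c : ℝ) :
      (v + c • P *ᵥ w) ⬝ᵥ (P⁻¹ *ᵥ (v + c • P *ᵥ w)) =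
        v ⬝ᵥ (P⁻¹ *ᵥ v) + 2 * c * (v ⬝ᵥ w) + c ^ 2 * (w ⬝ᵥ (P *ᵥ w)) := by
    have hinv : P⁻¹ *ᵥ (P *ᵥ w) = w := by
      rw [mulVec_mulVec, nonsing_inv_mul _ hP.det_pos.ne'.isUnit, one_mulVec]
    have hsymm : (P *ᵥ w) ⬝ᵥ (P⁻¹ *ᵥ v) = v ⬝ᵥ w := by
      have hPt : P⁻¹ᵀ = P⁻¹ := by
        simpa [conjTranspose_eq_transpose_of_trivial] using hP.inv.isHermitian.eq
      rw [dotProduct_mulVec, ← mulVec_transpose, hPt, hinv, dotProduct_comm]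
    rw [mulVec_add, mulVec_smul, hinv]
    simp only [add_dotProduct, dotProduct_add, smul_dotProduct, dotProduct_smul, smul_eq_mul,
      hsymm, dotProduct_comm (P *ᵥ w) w]
    ring
  have hS' := hquad hS (-(2 : ℝ)⁻¹)
  rw [neg_smul, ← sub_eq_add_neg] at hS'
  rw [hleft, hright, hS', hquad hT, dotProduct_comm (a - b), ← hMw]
  simp only [smul_mulVec, add_mulVec, dotProduct_add, dotProduct_smul, smul_eq_mul]
  ring

lemma Matrix.PosDef.det_half_smul_inv_add_inv {S T : Matrix ι ι ℝ}
    (hS : S.PosDef) (hT : T.PosDef) :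
    ((2 : ℝ)⁻¹ • (S⁻¹ + T⁻¹)).det = ((2 : ℝ)⁻¹ • (S + T)).det / (S.det * T.det) := by
  have hfactor : (2 : ℝ)⁻¹ • (S⁻¹ + T⁻¹) = S⁻¹ * ((2 : ℝ)⁻¹ • (S + T)) * T⁻¹ := by
    rw [Matrix.mul_smul, Matrix.smul_mul, Matrix.mul_add, Matrix.add_mul, nonsing_inv_mul _ hS.det_pos.ne'.isUnit,
      Matrix.one_mul, Matrix.mul_assoc, mul_nonsing_inv _ hT.det_pos.ne'.isUnit, Matrix.mul_one, add_comm]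
  rw [hfactor, det_mul, det_mul, det_nonsing_inv, det_nonsing_inv, Ring.inverse_eq_inv']
  have := hS.det_pos.ne'
  have := hT.det_pos.ne'
  field_simp

/-- The square root of the Gaussian density centred at `a` with covariance proportional to `S`,
up to a constant factor not depending on `a` and `S`. -/
noncomputable def gaussianFeature (S : Matrix ι ι ℝ) (a u : ι → ℝ) : ℝ :=
  S.det ^ (-(1 : ℝ) / 4) * Real.exp (-(2 * ((u - a) ⬝ᵥ (S⁻¹ *ᵥ (u - a)))))

lemma integral_gaussianFeature_mul {S T : Matrix ι ι ℝ} (hS : S.PosDef) (hT : T.PosDef)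
    (a b : ι → ℝ) :
    ∫ u, gaussianFeature S a u * gaussianFeature T b u =
      (∫ v : ι → ℝ, Real.exp (-4 * (v ⬝ᵥ v))) *
        (S.det ^ ((1 : ℝ) / 4) * T.det ^ ((1 : ℝ) / 4) *
          ((2 : ℝ)⁻¹ • (S + T)).det ^ (-(1 : ℝ) / 2) *
          Real.exp (-((a - b) ⬝ᵥ (((2 : ℝ)⁻¹ • (S + T))⁻¹ *ᵥ (a - b))))) := by
  have hM : ((2 : ℝ)⁻¹ • (S + T)).PosDef := (hS.add hT).smul (by norm_num)
  have hQ : ((2 : ℝ)⁻¹ • (S⁻¹ + T⁻¹)).PosDef := (hS.inv.add hT.inv).smul (by norm_num)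
  have hpoint (v : ι → ℝ) :
      gaussianFeature S a
          (v + (a - (2 : ℝ)⁻¹ • S *ᵥ (((2 : ℝ)⁻¹ • (S + T))⁻¹ *ᵥ (a - b)))) *
        gaussianFeature T b
          (v + (a - (2 : ℝ)⁻¹ • S *ᵥ (((2 : ℝ)⁻¹ • (S + T))⁻¹ *ᵥ (a - b)))) =
      S.det ^ (-(1 : ℝ) / 4) * T.det ^ (-(1 : ℝ) / 4) *
        Real.exp (-((a - b) ⬝ᵥ (((2 : ℝ)⁻¹ • (S + T))⁻¹ *ᵥ (a - b)))) *
        Real.exp (-4 * (v ⬝ᵥ (((2 : ℝ)⁻¹ • (S⁻¹ + T⁻¹)) *ᵥ v))) := by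
    rw [gaussianFeature, gaussianFeature, mul_mul_mul_comm, ← Real.exp_add, ← neg_add,
      hS.two_mul_quadratic_add_quadratic hT, neg_add, Real.exp_add, ← neg_mul]
    ring
  have hpow {x : ℝ} (hx : 0 < x) :
      x ^ (-(1 : ℝ) / 4) * (x ^ (-(1 : ℝ) / 2))⁻¹ = x ^ ((1 : ℝ) / 4) := by
    rw [← Real.rpow_neg hx.le, ← Real.rpow_add hx]
    norm_num
  rw [← integral_add_right_eq_self _
    (a - (2 : ℝ)⁻¹ • S *ᵥ (((2 : ℝ)⁻¹ • (S + T))⁻¹ *ᵥ (a - b)))]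
  simp_rw [hpoint]
  rw [integral_const_mul, hQ.integral_exp_neg_four_mul, hS.det_half_smul_inv_add_inv hT,
    Real.div_rpow hM.det_pos.le (mul_pos hS.det_pos hT.det_pos).le,
    Real.mul_rpow hS.det_pos.le hT.det_pos.le, ← hpow hS.det_pos, ← hpow hT.det_pos]
  ring

lemma integral_gaussianFeature_mul_pos {S T : Matrix ι ι ℝ} (hS : S.PosDef) (hT : T.PosDef)
    (a b : ι → ℝ) : 0 < ∫ u, gaussianFeature S a u * gaussianFeature T b u := by
  have hM : ((2 : ℝ)⁻¹ • (S + T)).PosDef := (hS.add hT).smul (by norm_num)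
  rw [integral_gaussianFeature_mul hS hT]
  have := integral_exp_neg_four_mul_dotProduct_self_pos (ι := ι)
  have := Real.rpow_pos_of_pos hS.det_pos ((1 : ℝ) / 4)
  have := Real.rpow_pos_of_pos hT.det_pos ((1 : ℝ) / 4)
  have := Real.rpow_pos_of_pos hM.det_pos (-(1 : ℝ) / 2)
  positivity

lemma integrable_gaussianFeature_mul {S T : Matrix ι ι ℝ} (hS : S.PosDef) (hT : T.PosDef)
    (a b : ι → ℝ) : Integrable fun u => gaussianFeature S a u * gaussianFeature T b u :=
  not_imp_comm.1 integral_undef (integral_gaussianFeature_mul_pos hS hT a b).ne'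

end

/-- A matrix of pairwise integrals of products of real functions is positive semidefinite. -/
lemma Matrix.posSemidef_of_integral_mul {α m : Type*} [MeasurableSpace α] [Fintype m]
    {μ : Measure α} (f : m → α → ℝ)
    (hf : ∀ i j, Integrable (fun u => f i u * f j u) μ) :
    (Matrix.of fun i j => ∫ u, f i u * f j u ∂μ).PosSemidef := by
  refine .of_dotProduct_mulVec_nonneg ?_ fun c => ?_
  · ext i j
    simp [mul_comm]
  · have h : star c ⬝ᵥ ((Matrix.of fun i j => ∫ u, f i u * f j u ∂μ) *ᵥ c) =
        ∫ u, (∑ i, c i * f i u) ^ 2 ∂μ := by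
      have hsq (u : α) : (∑ i, c i * f i u) ^ 2 =
          ∑ i, ∑ j, c i * c j * (f i u * f j u) := by
        rw [sq, Finset.sum_mul_sum]
        exact Finset.sum_congr rfl fun i _ => Finset.sum_congr rfl fun j _ => by ring
      simp_rw [hsq]
      rw [integral_finsetSum _ fun i _ => integrable_finsetSum _ fun j _ => (hf i j).const_mul _]
      simp only [dotProduct, mulVec, of_apply, star_trivial, Finset.mul_sum]
      refine Finset.sum_congr rfl fun i _ => ?_
      rw [integral_finsetSum _ fun j _ => (hf i j).const_mul _]
      refine Finset.sum_congr rfl fun j _ => ?_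
      rw [integral_const_mul]
      ring
    rw [h]
    exact integral_nonneg fun u => sq_nonneg _

/-- The Gaussian instance of the nonstationary covariance function
(Paciorek–Schervish, Eq. (2) of the paper): for any points `x i : ℝ^d` and spatially
varying symmetric positive definite length-scale matrices `S i`, the Gram matrix with
entries
`σf² (det S i)^(1/4) (det S j)^(1/4) det((S i + S j)/2)^(-1/2)
  exp(-(x i - x j)ᵀ ((S i + S j)/2)⁻¹ (x i - x j))`
is positive semidefinite. -/
theorem nonstationary_gaussian_covariance_posSemidef
    (d n : ℕ) (x : Fin n → (Fin d → ℝ))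
    (S : Fin n → Matrix (Fin d) (Fin d) ℝ) (hS : ∀ i, (S i).PosDef)
    (σf : ℝ) (hσf : 0 < σf) :
    Matrix.PosSemidef (Matrix.of fun i j : Fin n =>
      σf ^ 2 * (S i).det ^ ((1 : ℝ) / 4) * (S j).det ^ ((1 : ℝ) / 4) *
        ((2 : ℝ)⁻¹ • (S i + S j)).det ^ (-(1 : ℝ) / 2) *
        Real.exp (-((x i - x j) ⬝ᵥ (((2 : ℝ)⁻¹ • (S i + S j))⁻¹ *ᵥ (x i - x j))))) := by
  have hC := integral_exp_neg_four_mul_dotProduct_self_pos (ι := Fin d)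
  have hpos : 0 ≤ σf ^ 2 / ∫ v : Fin d → ℝ, Real.exp (-4 * (v ⬝ᵥ v)) := by positivity
  convert (posSemidef_of_integral_mul (fun i => gaussianFeature (S i) (x i)) fun i j =>
    integrable_gaussianFeature_mul (hS i) (hS j) (x i) (x j)).smul hpos using 1
  ext i j
  rw [Matrix.smul_apply, of_apply, of_apply, integral_gaussianFeature_mul (hS i) (hS j), smul_eq_mul,
    ← mul_assoc, div_mul_cancel₀ _ hC.ne']
  ring
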